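/- arXiv:1912.13068 — 2 statements merged into one kernel-verified Lean document; each statement's English description precedes it below -/
import Mathlib

section
/- Let X be a set and k : X → X → ℂ a PSD kernel which is irreducible, i.e., k(x,y) ≠ 0 for all x, y ∈ X and for all x ≠ y the functions k(·,x) and k(·,y) from X to ℂ are linearly independent. Then k has the complete Pick property if and only if for every z ∈ X the kernel F_z(x,y) := 1 − (k(x,z) * k(z,y)) / (k(z,z) * k(x,y)) is PSD. -/
open ComplexOrder Matrix

/-- A kernel `k : X → X → ℂ` is positive semidefinite if for every finite tuple of points the
associated Gram-type matrix is positive semidefinite. -/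
def IsPSDKernel {X : Type*} (k : X → X → ℂ) : Prop :=
  ∀ (n : ℕ) (x : Fin n → X), (Matrix.of fun i j : Fin n => k (x i) (x j)).PosSemidef

/-- Given `W : X → Matrix (Fin s) (Fin t) ℂ`, the operator-valued kernel `(1 - W W*) k` is PSD:
for every tuple `x : Fin n → X`, the block matrix with `((i,a),(j,b))` entry
`k (x i) (x j) * ((1 - W (x i) * (W (x j))ᴴ) a b)` is positive semidefinite. -/
def MultKernelPSD {X : Type*} (k : X → X → ℂ) {s t : ℕ}
    (W : X → Matrix (Fin s) (Fin t) ℂ) : Prop :=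
  ∀ (n : ℕ) (x : Fin n → X),
    (Matrix.of fun p q : Fin n × Fin s =>
      k (x p.1) (x q.1) *
        ((1 : Matrix (Fin s) (Fin s) ℂ) - W (x p.1) * (W (x q.1))ᴴ) p.2 q.2).PosSemidef

/-- The kernel `k` has the complete Pick property (matrix formulation): for all `s t : ℕ`, every
finite subset `S ⊆ X` and every `W : X → Matrix (Fin s) (Fin t) ℂ` such that `(1 - W W*) k` is
PSD on tuples of points from `S`, there is a `Φ : X → Matrix (Fin s) (Fin t) ℂ` agreeing with
`W` on `S` such that `(1 - Φ Φ*) k` is PSD on all of `X`. -/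
def CompletePickProperty {X : Type*} (k : X → X → ℂ) : Prop :=
  ∀ (s t : ℕ) (S : Finset X) (W : X → Matrix (Fin s) (Fin t) ℂ),
    (∀ (n : ℕ) (x : Fin n → X), (∀ i, x i ∈ S) →
      (Matrix.of fun p q : Fin n × Fin s =>
        k (x p.1) (x q.1) *
          ((1 : Matrix (Fin s) (Fin s) ℂ) - W (x p.1) * (W (x q.1))ᴴ) p.2 q.2).PosSemidef) →
    ∃ Φ : X → Matrix (Fin s) (Fin t) ℂ, (∀ x ∈ S, Φ x = W x) ∧ MultKernelPSD k Φ

theorem exists_isometric_linear {E F G : Type*} [NormedAddCommGroup E] [InnerProductSpace ℂ E]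
    [FiniteDimensional ℂ E] [NormedAddCommGroup F] [InnerProductSpace ℂ F] [FiniteDimensional ℂ F]
    [NormedAddCommGroup G] [InnerProductSpace ℂ G]
    (p : E →ₗ[ℂ] F) (q : E →ₗ[ℂ] G) (h : ∀ u, ‖p u‖ = ‖q u‖) :
    ∃ v : F →ₗ[ℂ] G, v ∘ₗ p = q ∧ ∀ y, ‖v y‖ ≤ ‖y‖ := by
  obtain ⟨r, hr⟩ := p.rangeRestrict.exists_rightInverse_of_surjective p.range_rangeRestrict
  have hpr : ∀ y : LinearMap.range p, p (r y) = y := fun y ↦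
    congrArg Subtype.val (LinearMap.congr_fun hr y)
  refine ⟨q ∘ₗ r ∘ₗ (LinearMap.range p).orthogonalProjectionOnto.toLinearMap, ?_, fun y ↦ ?_⟩
  · ext u
    have h1 : (LinearMap.range p).orthogonalProjectionOnto (p u) = p.rangeRestrict u :=
      Submodule.orthogonalProjectionOnto_mem_subspace_eq_self (p.rangeRestrict u)
    have h2 := h (r (p.rangeRestrict u) - u)
    rw [map_sub, map_sub, hpr, show (p.rangeRestrict u : F) = p u from rfl,
      sub_self, norm_zero, eq_comm, norm_eq_zero, sub_eq_zero] at h2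
    simpa [h1] using h2
  · have : ‖q (r ((LinearMap.range p).orthogonalProjectionOnto y))‖ ≤ ‖y‖ := by
      rw [← h, hpr]
      exact (LinearMap.range p).norm_orthogonalProjectionOnto_apply_le y
    simpa using this

theorem norm_sq_toEuclideanLin {m n : Type*} [Fintype m] [Fintype n] [DecidableEq n]
    (P : Matrix m n ℂ) (u : EuclideanSpace ℂ n) :
    ((‖P.toEuclideanLin u‖ : ℂ)) ^ 2 = star u.ofLp ⬝ᵥ ((Pᴴ * P) *ᵥ u.ofLp) := by
  have := inner_self_eq_norm_sq_to_K (𝕜 := ℂ) (P.toEuclideanLin u)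
  rw [← Complex.coe_algebraMap, ← this, EuclideanSpace.inner_eq_star_dotProduct,
    Matrix.ofLp_toLpLin, Matrix.toLin'_apply, ← Matrix.mulVec_mulVec, Matrix.dotProduct_mulVec,
    Matrix.vecMul_conjTranspose, star_star, dotProduct_comm]

theorem Matrix.exists_contraction_mul_eq {m n p : Type*} [Fintype m] [Fintype n] [Fintype p]
    [DecidableEq m] (P : Matrix m p ℂ) (Q : Matrix n p ℂ) (h : Pᴴ * P = Qᴴ * Q) :
    ∃ V : Matrix n m ℂ, V * P = Q ∧ (1 - Vᴴ * V).PosSemidef := by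
  classical
  obtain ⟨v, hv, hle⟩ := exists_isometric_linear P.toEuclideanLin Q.toEuclideanLin fun u ↦ by
    have h1 := norm_sq_toEuclideanLin P u
    rw [h, ← norm_sq_toEuclideanLin] at h1
    norm_cast at h1
    exact (sq_eq_sq₀ (norm_nonneg _) (norm_nonneg _)).1 h1
  obtain ⟨V, rfl⟩ := Matrix.toEuclideanLin.surjective v
  refine ⟨V, ?_, ?_⟩
  · apply Matrix.toEuclideanLin.injective
    rw [← hv]
    ext u i
    simp [Matrix.toLpLin_apply]
  · refine .of_dotProduct_mulVec_nonneg ?_ fun x ↦ ?_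
    · simp [Matrix.IsHermitian]
    · have h1 := norm_sq_toEuclideanLin V (WithLp.toLp 2 x)
      have h2 := norm_sq_toEuclideanLin (1 : Matrix m m ℂ) (WithLp.toLp 2 x)
      simp only [Matrix.conjTranspose_one, one_mul] at h1 h2
      rw [Matrix.sub_mulVec, dotProduct_sub, ← h1, ← h2]
      have h3 := hle (WithLp.toLp 2 x)
      simp only [Matrix.toLpLin_apply, Matrix.one_mulVec] at h3 ⊢
      rw [sub_nonneg]
      norm_cast
      gcongr

theorem exists_contraction_family {m n s σ : Type*} [Fintype m] [Fintype n] [Fintype s] [Fintype σ]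
    [DecidableEq m] (p : σ → Matrix m s ℂ) (q : σ → Matrix n s ℂ)
    (h : ∀ i j, (p i)ᴴ * p j = (q i)ᴴ * q j) :
    ∃ V : Matrix n m ℂ, (∀ i, V * p i = q i) ∧ (1 - Vᴴ * V).PosSemidef := by
  obtain ⟨V, hV, hV'⟩ := Matrix.exists_contraction_mul_eq
    (Matrix.of fun r (c : σ × s) ↦ p c.1 r c.2) (Matrix.of fun r (c : σ × s) ↦ q c.1 r c.2) (by
      ext c d
      exact congrFun (congrFun (h c.1 d.1) c.2) d.2)
  exact ⟨V, fun i ↦ by ext r a; exact congrFun (congrFun hV r) (i, a), hV'⟩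

theorem exists_gram_family {s σ : Type*} [Fintype s] [Fintype σ] {A : σ → σ → Matrix s s ℂ}
    (hA : (Matrix.of fun p q : σ × s ↦ A p.1 q.1 p.2 q.2).PosSemidef) :
    ∃ g : σ → Matrix (σ × s) s ℂ, ∀ i j, (g i)ᴴ * g j = A i j := by
  classical
  open scoped MatrixOrder in
  obtain ⟨B, hB⟩ := CStarAlgebra.nonneg_iff_eq_star_mul_self.mp hA.nonneg
  refine ⟨fun i ↦ Matrix.of fun r a ↦ B r (i, a), fun i j ↦ ?_⟩
  ext a b
  exact (congrFun (congrFun hB (i, a)) (j, b)).symm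

theorem posSemidef_sandwich_family {s ι N : Type*} [Finite s] [Finite ι] [Fintype N]
    {M : Matrix N N ℂ} (hM : M.PosSemidef) (g : ι → Matrix N s ℂ) :
    (Matrix.of fun p q : ι × s ↦ ((g p.1)ᴴ * M * g q.1) p.2 q.2).PosSemidef :=
  hM.conjTranspose_mul_mul_same (Matrix.of fun r (p : ι × s) ↦ g p.1 r p.2)

theorem isUnit_one_sub_mul {M N : Type*} [Fintype M] [Fintype N] [DecidableEq M] [DecidableEq N]
    {D : Matrix N M ℂ} {E : Matrix M N ℂ} {β : ℂ} (hβ : β < 1) (hE : Eᴴ * E = β • 1)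
    (hD : (1 - Dᴴ * D).PosSemidef) : IsUnit (1 - D * E) := by
  rw [← Matrix.mulVec_injective_iff_isUnit, ← Matrix.coe_mulVecLin, injective_iff_map_eq_zero]
  intro v hv
  rw [Matrix.mulVecLin_apply, Matrix.sub_mulVec, Matrix.one_mulVec, sub_eq_zero,
    ← Matrix.mulVec_mulVec] at hv
  have h1 := hD.dotProduct_mulVec_nonneg (E *ᵥ v)
  have h2 : star (E *ᵥ v) ⬝ᵥ ((1 - Dᴴ * D) *ᵥ (E *ᵥ v)) = (β - 1) * (star v ⬝ᵥ v) := by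
    have h3 : star (E *ᵥ v) ⬝ᵥ (E *ᵥ v) = β * (star v ⬝ᵥ v) := by
      rw [Matrix.star_mulVec, ← Matrix.dotProduct_mulVec, Matrix.mulVec_mulVec, hE,
        Matrix.smul_mulVec, Matrix.one_mulVec, dotProduct_smul, smul_eq_mul]
    have h4 : star (E *ᵥ v) ⬝ᵥ ((Dᴴ * D) *ᵥ (E *ᵥ v)) = star v ⬝ᵥ v := by
      rw [← Matrix.mulVec_mulVec, ← hv, Matrix.dotProduct_mulVec, ← Matrix.star_mulVec, ← hv]
    rw [Matrix.sub_mulVec, Matrix.one_mulVec, dotProduct_sub, h3, h4]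
    ring
  rw [h2] at h1
  have h5 : 0 ≤ star v ⬝ᵥ v := dotProduct_star_self_nonneg v
  have h6 : star v ⬝ᵥ v ≤ 0 := by
    by_contra h
    have : 0 < star v ⬝ᵥ v := lt_of_le_of_ne h5 fun h' ↦ h h'.symm.le
    exact absurd (mul_neg_of_neg_of_pos (sub_neg.2 hβ) this) (not_lt_of_ge h1)
  exact dotProduct_star_self_eq_zero.1 (le_antisymm h6 h5)

/-- The `i`-th column of `B` tensored with the identity matrix on `N`, that is, the block column
whose `l`-th block is the scalar matrix `B l i`. -/
def ampliation {L ι : Type*} (B : Matrix L ι ℂ) (N : Type*) [DecidableEq N] (i : ι) :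
    Matrix (L × N) N ℂ :=
  Matrix.of fun r q ↦ B r.1 i * (1 : Matrix N N ℂ) r.2 q

theorem ampliation_gram {L ι N : Type*} [Fintype L] [Fintype N] [DecidableEq N] (B : Matrix L ι ℂ)
    (i j : ι) : (ampliation B N i)ᴴ * ampliation B N j = (Bᴴ * B) i j • 1 := by
  ext p q
  simp only [ampliation, Matrix.mul_apply, Matrix.conjTranspose_apply, Matrix.of_apply,
    Fintype.sum_prod_type, Matrix.smul_apply, smul_eq_mul, Finset.sum_mul]
  refine Finset.sum_congr rfl fun l _ ↦ ?_
  by_cases h : p = q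
  · subst h; simp [Matrix.one_apply]
  · simp [Matrix.one_apply, h, Ne.symm h]

/-- The lurking isometry argument: if `κ * (1 - Bᴴ * B)` is a rank one kernel `δ δ*` then an
contractive interpolation problem on the points `e` extends to all of `ι`. -/
theorem exists_realization {ι σ L s t : Type*} [Finite ι] [Fintype σ] [Fintype L] [Fintype s]
    [Fintype t] [DecidableEq s] {κ : Matrix ι ι ℂ} (hκ : κ.PosSemidef) {δ : ι → ℂ}
    (hδ : ∀ i, δ i ≠ 0)
    {B : Matrix L ι ℂ} (hB : ∀ i j, κ i j * (1 - (Bᴴ * B) i j) = δ i * star (δ j))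
    (e : σ → ι) (W : σ → Matrix s t ℂ)
    (hW : (Matrix.of fun p q : σ × s ↦
      κ (e p.1) (e q.1) * ((1 : Matrix s s ℂ) - W p.1 * (W q.1)ᴴ) p.2 q.2).PosSemidef) :
    ∃ Φ : ι → Matrix s t ℂ, (∀ i, Φ (e i) = W i) ∧
      (Matrix.of fun p q : ι × s ↦
        κ p.1 q.1 * ((1 : Matrix s s ℂ) - Φ p.1 * (Φ q.1)ᴴ) p.2 q.2).PosSemidef := by
  classical
  have hlt : ∀ i, (Bᴴ * B) i i < 1 := fun i ↦ by
    have h1 : 0 < κ i i * (1 - (Bᴴ * B) i i) := by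
      rw [hB]
      exact mul_star_self_pos (IsRegular.of_ne_zero (hδ i))
    have h2 : 0 < κ i i :=
      lt_of_le_of_ne hκ.diag_nonneg fun h ↦ h1.ne' (by rw [← h, zero_mul])
    exact sub_pos.1 ((mul_pos_iff_of_pos_left h2).1 h1)
  obtain ⟨g, hg⟩ := exists_gram_family
    (A := fun i j ↦ κ (e i) (e j) • (1 - W i * (W j)ᴴ)) hW
  set γ : σ → Matrix (σ × s) s ℂ := fun i ↦ (star (δ (e i)))⁻¹ • g i with hγ
  have hγγ : ∀ i j, 1 - W i * (W j)ᴴ = (1 - (Bᴴ * B) (e i) (e j)) • ((γ i)ᴴ * γ j) := fun i j ↦ by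
    have h1 := star_ne_zero.2 (hδ (e j))
    have h2 : κ (e i) (e j) ≠ 0 := fun h ↦
      mul_ne_zero (hδ (e i)) h1 (by rw [← hB, h, zero_mul])
    simp only [hγ, conjTranspose_smul, Matrix.smul_mul, Matrix.mul_smul, hg, smul_smul]
    rw [eq_comm]
    convert one_smul ℂ _ using 2
    rw [star_inv₀, star_star]
    field_simp [hδ (e i)]
    linear_combination hB (e i) (e j)
  obtain ⟨V, hV, hV1⟩ := exists_contraction_family
    (fun i ↦ fromRows (1 : Matrix s s ℂ) (ampliation B (σ × s) (e i) * γ i))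
    (fun i ↦ fromRows (W i)ᴴ (γ i))
    fun i j ↦ by
      have := hγγ i j
      simp only [conjTranspose_fromRows_eq_fromCols_conjTranspose, fromCols_mul_fromRows,
        conjTranspose_one, one_mul, conjTranspose_mul, conjTranspose_conjTranspose]
      rw [Matrix.mul_assoc, ← Matrix.mul_assoc _ _ (γ j), ampliation_gram]
      rw [sub_smul, one_smul, sub_eq_sub_iff_add_eq_add] at this
      simpa [add_comm] using this
  obtain ⟨V₁₁, V₁₂, V₂₁, V₂₂, rfl⟩ : ∃ V₁₁ V₁₂ V₂₁ V₂₂, V = fromBlocks V₁₁ V₁₂ V₂₁ V₂₂ :=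
    ⟨_, _, _, _, (fromBlocks_toBlocks V).symm⟩
  have hV22 : (1 - V₂₂ᴴ * V₂₂).PosSemidef := by
    have h1 := (hV1.submatrix Sum.inr).add (posSemidef_conjTranspose_mul_self V₁₂)
    rw [fromBlocks_conjTranspose, fromBlocks_multiply, ← fromBlocks_one] at h1
    convert h1 using 1
    ext a b
    simp only [Matrix.sub_apply, Matrix.add_apply, submatrix_apply, fromBlocks_apply₂₂]
    ring
  have hU : ∀ i, IsUnit (1 - V₂₂ * ampliation B (σ × s) i) := fun i ↦
    isUnit_one_sub_mul (hlt i) (ampliation_gram B i i) hV22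
  set Γ : ι → Matrix (σ × s) s ℂ := fun i ↦ (1 - V₂₂ * ampliation B (σ × s) i)⁻¹ * V₂₁ with hΓ
  have hΓ1 : ∀ i, V₂₁ + V₂₂ * (ampliation B (σ × s) i * Γ i) = Γ i := fun i ↦ by
    have : (1 - V₂₂ * ampliation B (σ × s) i) * Γ i = V₂₁ := by
      rw [hΓ, Matrix.mul_nonsing_inv_cancel_left _ _ ((isUnit_iff_isUnit_det _).1 (hU i))]
    rw [Matrix.sub_mul, Matrix.one_mul, Matrix.mul_assoc] at this
    rw [← this, sub_add_cancel]
  have hW' : ∀ i, V₁₁ + V₁₂ * (ampliation B (σ × s) (e i) * γ i) = (W i)ᴴ ∧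
      V₂₁ + V₂₂ * (ampliation B (σ × s) (e i) * γ i) = γ i := fun i ↦ by
    have := hV i
    rw [fromBlocks_mul_fromRows] at this
    simpa using fromRows_inj this
  have hΓ2 : ∀ i, Γ (e i) = γ i := fun i ↦ by
    have : V₂₁ = (1 - V₂₂ * ampliation B (σ × s) (e i)) * γ i := by
      rw [Matrix.sub_mul, Matrix.one_mul, Matrix.mul_assoc]
      exact eq_sub_of_add_eq (hW' i).2
    rw [hΓ]
    simp only
    rw [this, Matrix.nonsing_inv_mul_cancel_left _ _ ((isUnit_iff_isUnit_det _).1 (hU (e i)))]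
  refine ⟨fun i ↦ (V₁₁ + V₁₂ * (ampliation B (σ × s) i * Γ i))ᴴ, fun i ↦ ?_, ?_⟩
  · simp only [hΓ2]
    rw [(hW' i).1, conjTranspose_conjTranspose]
  set Ψ : ι → Matrix t s ℂ := fun i ↦ V₁₁ + V₁₂ * (ampliation B (σ × s) i * Γ i) with hΨ
  set P : ι → Matrix (s ⊕ L × (σ × s)) s ℂ :=
    fun i ↦ fromRows 1 (ampliation B (σ × s) i * Γ i) with hP
  have hVP : ∀ i, fromBlocks V₁₁ V₁₂ V₂₁ V₂₂ * P i = fromRows (Ψ i) (Γ i) := fun i ↦ by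
    simp only [hP, hΨ, fromBlocks_mul_fromRows, Matrix.mul_one, hΓ1]
  have key : ∀ i j, 1 - (Ψ i)ᴴ * Ψ j = (1 - (Bᴴ * B) i j) • ((Γ i)ᴴ * Γ j) +
      (P i)ᴴ * (1 - (fromBlocks V₁₁ V₁₂ V₂₁ V₂₂)ᴴ * fromBlocks V₁₁ V₁₂ V₂₁ V₂₂) * P j :=
      fun i j ↦ by
    have h1 : (P i)ᴴ * P j = 1 + (Bᴴ * B) i j • ((Γ i)ᴴ * Γ j) := by
      simp only [hP, conjTranspose_fromRows_eq_fromCols_conjTranspose, fromCols_mul_fromRows,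
        conjTranspose_one, one_mul, conjTranspose_mul]
      rw [Matrix.mul_assoc, ← Matrix.mul_assoc _ _ (Γ j), ampliation_gram, Matrix.smul_mul,
        Matrix.mul_smul, Matrix.one_mul]
    have h2 : (P i)ᴴ * ((fromBlocks V₁₁ V₁₂ V₂₁ V₂₂)ᴴ * fromBlocks V₁₁ V₁₂ V₂₁ V₂₂) * P j =
        (Ψ i)ᴴ * Ψ j + (Γ i)ᴴ * Γ j := by
      rw [← Matrix.mul_assoc, Matrix.mul_assoc, ← conjTranspose_mul, hVP, hVP,
        conjTranspose_fromRows_eq_fromCols_conjTranspose, fromCols_mul_fromRows]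
    rw [Matrix.mul_sub, Matrix.sub_mul, Matrix.mul_one, h1, h2, sub_smul, one_smul]
    abel
  have h1 := posSemidef_sandwich_family PosSemidef.one fun i ↦ star (δ i) • Γ i
  have h2 := posSemidef_sandwich_family hV1 P
  convert h1.add ((hκ.submatrix (Prod.fst : ι × s → ι)).hadamard h2) using 1
  ext p q
  change κ p.1 q.1 * ((1 : Matrix s s ℂ) - (Ψ p.1)ᴴ * ((Ψ q.1)ᴴ)ᴴ) p.2 q.2 = _
  rw [conjTranspose_conjTranspose, key]
  simp only [of_apply, Matrix.add_apply, hadamard_apply, submatrix_apply, Matrix.mul_one,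
    conjTranspose_smul, Matrix.smul_mul, Matrix.mul_smul, Matrix.smul_apply, smul_eq_mul,
    star_star]
  linear_combination ((Γ p.1)ᴴ * Γ q.1) p.2 q.2 * hB p.1 q.1

theorem IsPSDKernel.star_apply {X : Type*} {k : X → X → ℂ} (hk : IsPSDKernel k) (x y : X) :
    star (k x y) = k y x :=
  (hk 2 ![x, y]).isHermitian.apply 1 0

theorem IsPSDKernel.apply_self_pos {X : Type*} {k : X → X → ℂ} (hk : IsPSDKernel k) {x : X}
    (hx : k x x ≠ 0) : 0 < k x x :=
  lt_of_le_of_ne ((hk 1 ![x]).diag_nonneg (i := 0)) hx.symm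

theorem IsPSDKernel.posSemidef {X ι : Type*} [Fintype ι] {k : X → X → ℂ} (hk : IsPSDKernel k)
    (e : ι → X) : (Matrix.of fun i j ↦ k (e i) (e j)).PosSemidef := by
  have h := (hk _ (e ∘ (Fintype.equivFin ι).symm)).submatrix (Fintype.equivFin ι)
  convert h using 1
  ext i j
  simp

theorem posSemidef_block_of_tuples {X ι : Type*} [Fintype ι] {S : Set X} {s : ℕ}
    {A : X → X → Fin s → Fin s → ℂ}
    (h : ∀ (n : ℕ) (x : Fin n → X), (∀ i, x i ∈ S) →
      (Matrix.of fun p q : Fin n × Fin s ↦ A (x p.1) (x q.1) p.2 q.2).PosSemidef)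
    (e : ι → X) (he : ∀ i, e i ∈ S) :
    (Matrix.of fun p q : ι × Fin s ↦ A (e p.1) (e q.1) p.2 q.2).PosSemidef := by
  have h := (h _ (e ∘ (Fintype.equivFin ι).symm) fun _ ↦ he _).submatrix
    (Prod.map (Fintype.equivFin ι) id)
  convert h using 1
  ext p q
  simp

theorem exists_gram_matrix {n : Type*} [Fintype n] {A : Matrix n n ℂ} (hA : A.PosSemidef) :
    ∃ B : Matrix n n ℂ, Bᴴ * B = A := by
  classical
  open scoped MatrixOrder in
  obtain ⟨B, hB⟩ := CStarAlgebra.nonneg_iff_eq_star_mul_self.mp hA.nonneg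
  exact ⟨B, hB.symm⟩

section Sufficiency

variable {X : Type*} {k : X → X → ℂ} {s t : ℕ}

theorem exists_extension_finset (hpsd : IsPSDKernel k) (hnz : ∀ x y, k x y ≠ 0) (z : X)
    (hF : IsPSDKernel fun x y ↦ 1 - (k x z * k z y) / (k z z * k x y))
    {S T : Finset X} (hST : S ⊆ T) {W : X → Matrix (Fin s) (Fin t) ℂ}
    (hW : ∀ (n : ℕ) (x : Fin n → X), (∀ i, x i ∈ S) →
      (Matrix.of fun p q : Fin n × Fin s =>
        k (x p.1) (x q.1) *
          ((1 : Matrix (Fin s) (Fin s) ℂ) - W (x p.1) * (W (x q.1))ᴴ) p.2 q.2).PosSemidef) :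
    ∃ Φ : X → Matrix (Fin s) (Fin t) ℂ, (∀ x ∈ S, Φ x = W x) ∧ (∀ x ∉ T, Φ x = 0) ∧
      (Matrix.of fun p q : T × Fin s ↦ k p.1 q.1 *
        ((1 : Matrix (Fin s) (Fin s) ℂ) - Φ p.1 * (Φ q.1)ᴴ) p.2 q.2).PosSemidef := by
  classical
  obtain ⟨B, hB⟩ := exists_gram_matrix (hF.posSemidef fun x : T ↦ (x : X))
  obtain ⟨c, hc⟩ : ∃ c : ℂ, c * star c = (k z z)⁻¹ := by
    obtain ⟨c, hc⟩ := CStarAlgebra.nonneg_iff_eq_star_mul_self.1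
      (inv_pos.2 (hpsd.apply_self_pos (hnz z z))).le
    exact ⟨c, by rw [hc, mul_comm]⟩
  have hc0 : c ≠ 0 := fun h ↦ inv_ne_zero (hnz z z) (by rw [← hc, h, zero_mul])
  have hWS := posSemidef_block_of_tuples (S := (S : Set X))
    (A := fun x y a b ↦ k x y * ((1 : Matrix (Fin s) (Fin s) ℂ) - W x * (W y)ᴴ) a b) hW
    (fun x : S ↦ (x : X)) fun x ↦ x.2
  obtain ⟨Φ, hΦ, hΦ'⟩ := exists_realization (hpsd.posSemidef fun x : T ↦ (x : X))
    (δ := fun x : T ↦ c * k x z) (fun x ↦ mul_ne_zero hc0 (hnz _ _)) (B := B)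
    (fun i j ↦ by
      have := hnz i j
      have := hnz z z
      rw [hB, star_mul, hpsd.star_apply]
      simp only [of_apply]
      rw [show c * k i z * (k z j * star c) = (c * star c) * (k i z * k z j) by ring, hc]
      field_simp
      ring)
    (fun x : S ↦ (⟨x, hST x.2⟩ : T)) (fun x : S ↦ W x) hWS
  refine ⟨fun x ↦ if h : x ∈ T then Φ ⟨x, h⟩ else 0, fun x hx ↦ ?_, fun x hx ↦ ?_, ?_⟩
  · simpa [hST hx] using hΦ ⟨x, hx⟩
  · simp [hx]
  · simpa using hΦ'

theorem norm_apply_le_one_of_block_posSemidef {ι : Type*} {κ : ι → ι → ℂ}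
    {Φ : ι → Matrix (Fin s) (Fin t) ℂ} {i : ι} (hκ : 0 < κ i i)
    (h : (Matrix.of fun p q : ι × Fin s ↦ κ p.1 q.1 *
        ((1 : Matrix (Fin s) (Fin s) ℂ) - Φ p.1 * (Φ q.1)ᴴ) p.2 q.2).PosSemidef)
    (a : Fin s) (b : Fin t) : ‖Φ i a b‖ ≤ 1 := by
  have h1 : 0 ≤ κ i i * ((1 : Matrix (Fin s) (Fin s) ℂ) - Φ i * (Φ i)ᴴ) a a :=
    h.diag_nonneg (i := (i, a))
  replace h1 := mul_nonneg (inv_pos.2 hκ).le h1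
  rw [inv_mul_cancel_left₀ hκ.ne', Matrix.sub_apply, Matrix.one_apply_eq, Matrix.mul_apply,
    sub_nonneg] at h1
  simp only [conjTranspose_apply, RCLike.star_def, Complex.mul_conj'] at h1
  have h2 : ∑ b, ‖Φ i a b‖ ^ 2 ≤ 1 := by exact_mod_cast h1
  have h3 := (Finset.single_le_sum (f := fun b ↦ ‖Φ i a b‖ ^ 2) (fun _ _ ↦ sq_nonneg _)
    (Finset.mem_univ b)).trans h2
  exact (sq_le_one_iff₀ (norm_nonneg _)).1 h3

theorem isClosed_setOf_matrix_posSemidef (ι : Type*) [Fintype ι] :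
    IsClosed {M : Matrix ι ι ℂ | M.PosSemidef} := by
  simp only [Matrix.posSemidef_iff_dotProduct_mulVec, Set.ofPred_and, Set.ofPred_forall]
  refine (isClosed_eq (by fun_prop) (by fun_prop)).inter (isClosed_iInter fun x ↦ ?_)
  exact isClosed_le continuous_const (by fun_prop)

theorem completePickProperty_of_isPSDKernel (hpsd : IsPSDKernel k) (hnz : ∀ x y, k x y ≠ 0)
    (z : X) (hF : IsPSDKernel fun x y ↦ 1 - (k x z * k z y) / (k z z * k x y)) :
    CompletePickProperty k := by
  classical
  intro s t S W hW
  let C : Finset X → Set (X → Matrix (Fin s) (Fin t) ℂ) := fun T ↦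
    {Φ | ∀ x a b, Φ x a b ∈ Metric.closedBall (0 : ℂ) 1} ∩ ({Φ | ∀ x ∈ S, Φ x = W x} ∩
      {Φ | (Matrix.of fun p q : (S ∪ T : Finset X) × Fin s ↦ k p.1 q.1 *
        ((1 : Matrix (Fin s) (Fin s) ℂ) - Φ p.1 * (Φ q.1)ᴴ) p.2 q.2).PosSemidef})
  have hball : IsCompact {Φ : X → Matrix (Fin s) (Fin t) ℂ |
      ∀ x a b, Φ x a b ∈ Metric.closedBall (0 : ℂ) 1} := by
    have := isCompact_pi_infinite (X := fun _ : X ↦ Fin s → Fin t → ℂ) fun _ ↦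
      isCompact_pi_infinite fun _ ↦ isCompact_pi_infinite fun _ ↦
        isCompact_closedBall (0 : ℂ) 1
    exact this
  have hclosed : ∀ T, IsClosed (C T) := fun T ↦ by
    refine hball.isClosed.inter (.inter ?_ ?_)
    · simp only [Set.ofPred_forall]
      exact isClosed_biInter fun x _ ↦ isClosed_eq (by fun_prop) (by fun_prop)
    · refine (isClosed_setOf_matrix_posSemidef _).preimage ?_
      refine continuous_matrix fun p q ↦ ?_
      simp only [of_apply]
      refine continuous_const.mul (Continuous.matrix_elem ?_ _ _)
      fun_prop
  obtain ⟨Φ, hΦ⟩ := IsCompact.nonempty_iInter_of_directed_nonempty_isCompact_isClosed C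
    (fun T₁ T₂ ↦ by
      have hmono : ∀ {T T' : Finset X}, T ⊆ T' → C T' ⊆ C T := fun {T T'} h Φ hΦ ↦
        ⟨hΦ.1, hΦ.2.1, hΦ.2.2.submatrix (Prod.map
          (Set.inclusion (Finset.union_subset_union_right h) :
            (S ∪ T : Finset X) → (S ∪ T' : Finset X)) id)⟩
      exact ⟨T₁ ∪ T₂, hmono Finset.subset_union_left, hmono Finset.subset_union_right⟩)
    (fun T ↦ by
      obtain ⟨Φ, h1, h2, h3⟩ :=
        exists_extension_finset hpsd hnz z hF (Finset.subset_union_left (s₂ := T)) hW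
      refine ⟨Φ, fun x a b ↦ ?_, h1, h3⟩
      rw [mem_closedBall_zero_iff]
      by_cases hx : x ∈ S ∪ T
      · exact norm_apply_le_one_of_block_posSemidef (i := (⟨x, hx⟩ : (S ∪ T : Finset X)))
          (κ := fun x y : (S ∪ T : Finset X) ↦ k x y) (Φ := fun x ↦ Φ x)
          (hpsd.apply_self_pos (hnz x x)) h3 a b
      · simp [h2 x hx])
    (fun T ↦ hball.of_isClosed_subset (hclosed T) fun _ h ↦ h.1) hclosed
  rw [Set.mem_iInter] at hΦ
  refine ⟨Φ, (hΦ ∅).2.1, fun n x ↦ ?_⟩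
  exact (hΦ (Finset.univ.image x)).2.2.submatrix (Prod.map (fun i ↦ ⟨x i, by simp⟩) id)

end Sufficiency

section Necessity

variable {X : Type*} {k : X → X → ℂ} {t : ℕ}

theorem posSemidef_mul_of_multKernelPSD {ι : Type*} [Fintype ι] (hpsd : IsPSDKernel k)
    (hnz : ∀ x y, k x y ≠ 0) {Φ : X → Matrix (Fin 1) (Fin t) ℂ} (hΦ : MultKernelPSD k Φ)
    (e : ι → X) (z : X) :
    (Matrix.of fun i j ↦ (1 - (k (e i) z * k z (e j)) / (k z z * k (e i) (e j))) *
      (k (e i) (e j) * (1 - Φ (e i) * (Φ (e j))ᴴ : Matrix (Fin 1) (Fin 1) ℂ) 0 0)).PosSemidef := by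
  classical
  let e' : Option ι → X := fun o ↦ o.elim z e
  have h0 := (posSemidef_block_of_tuples (S := Set.univ)
      (A := fun x y a b ↦ k x y * ((1 : Matrix (Fin 1) (Fin 1) ℂ) - Φ x * (Φ y)ᴴ) a b)
      (fun n x _ ↦ hΦ n x) e' fun _ ↦ Set.mem_univ _).submatrix fun o ↦ (o, (0 : Fin 1))
  have h1 := h0.conjTranspose_mul_mul_same (Matrix.of fun (o : Option ι) (j : ι) ↦
    o.elim (-(k z (e j) / k z z)) fun i ↦ if i = j then (1 : ℂ) else 0)
  have h2 := (posSemidef_conjTranspose_mul_self (Matrix.of fun (b : Fin t) (j : ι) ↦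
    k z (e j) * star (Φ (e j) 0 b - Φ z 0 b))).smul
      (inv_pos.2 (hpsd.apply_self_pos (hnz z z))).le
  convert h1.add h2 using 1
  ext i j
  have h3 := hnz z z
  have h4 := hnz (e i) (e j)
  have h5 : ∀ x, (starRingEnd ℂ) (k z x) = k x z := hpsd.star_apply z
  have h6 : ∀ (u v : ℂ) (p q r : Fin t → ℂ), ∑ b, u * (p b - r b) * (v * (star (q b) - star (r b)))
      = u * v * (∑ b, p b * star (q b) - ∑ b, p b * star (r b) - ∑ b, r b * star (q b) +
        ∑ b, r b * star (r b)) := fun u v p q r ↦ by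
    simp only [← Finset.sum_sub_distrib, ← Finset.sum_add_distrib, Finset.mul_sum]
    exact Finset.sum_congr rfl fun _ _ ↦ by ring
  simp only [RCLike.star_def] at h6
  simp only [Matrix.mul_apply, Fintype.sum_option, e', of_apply, submatrix_apply,
    conjTranspose_apply, Matrix.sub_apply, Matrix.add_apply, Matrix.smul_apply, smul_eq_mul,
    Option.elim_none, Option.elim_some, Matrix.one_apply_eq, RCLike.star_def, map_neg, map_div₀,
    map_mul, map_sub, RCLike.conj_conj, apply_ite (starRingEnd ℂ), map_one, map_zero, ite_mul,
    mul_ite, one_mul, mul_one, zero_mul, mul_zero, Finset.sum_ite_eq', Finset.mem_univ, if_true,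
    h5, h6]
  field_simp
  ring

theorem isPSDKernel_of_completePickProperty (hpsd : IsPSDKernel k) (hnz : ∀ x y, k x y ≠ 0)
    (hP : CompletePickProperty k) (z : X) :
    IsPSDKernel fun x y ↦ 1 - (k x z * k z y) / (k z z * k x y) := by
  classical
  suffices H : ∀ (S : Finset X) (z : X), (Matrix.of fun i j : S ↦
      1 - (k i z * k z j) / (k z z * k i j)).PosSemidef from fun n x ↦
    (H (Finset.univ.image x) z).submatrix fun i ↦ ⟨x i, by simp⟩
  intro S
  induction S using Finset.induction_on with
  | empty =>
    exact fun z ↦ .of_dotProduct_mulVec_nonneg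
      (by ext i; exact (Finset.notMem_empty _ i.2).elim) (by simp)
  | insert a S ha ih =>
    intro z
    obtain ⟨B, hB⟩ := exists_gram_matrix (ih a)
    let W : X → Matrix (Fin 1) (Fin (Fintype.card S)) ℂ := fun x ↦ Matrix.of fun _ l ↦
      if h : x ∈ S then star (B ((Fintype.equivFin S).symm l) ⟨x, h⟩) else 0
    have hWW : ∀ x ∈ insert a S, ∀ y ∈ insert a S, ∀ p q, (W x * (W y)ᴴ) p q =
        1 - (k x a * k a y) / (k a a * k x y) := fun x hx y hy p q ↦ by
      have h1 := hnz a a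
      have h2 := hnz x a
      have h3 := hnz a y
      rw [Matrix.mul_apply]
      by_cases hxS : x ∈ S
      · by_cases hyS : y ∈ S
        · have h4 := congrFun (congrFun hB ⟨x, hxS⟩) ⟨y, hyS⟩
          rw [of_apply, Matrix.mul_apply] at h4
          rw [← h4, ← (Fintype.equivFin S).symm.sum_comp]
          simp [W, hxS, hyS]
        · obtain rfl := (Finset.mem_insert.1 hy).resolve_right hyS
          simp [W, hyS]
          field_simp
          simp
      · obtain rfl := (Finset.mem_insert.1 hx).resolve_right hxS
        simp [W, hxS]
        field_simp
        simp
    have hWk : ∀ x ∈ insert a S, ∀ y ∈ insert a S, ∀ p q, k x y *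
        ((1 : Matrix (Fin 1) (Fin 1) ℂ) - W x * (W y)ᴴ) p q =
          (k a a)⁻¹ * (k x a * star (k y a)) := fun x hx y hy p q ↦ by
      have h1 := hnz x y
      have h2 := hnz a a
      rw [Matrix.sub_apply, hWW x hx y hy, Subsingleton.elim p q, Matrix.one_apply_eq,
        hpsd.star_apply]
      field_simp
      ring
    obtain ⟨Φ, hΦ, hΦ'⟩ := hP 1 _ (insert a S) W fun n x hx ↦ by
      convert (posSemidef_vecMulVec_self_star fun p : Fin n × Fin 1 ↦ k (x p.1) a).smul
        (inv_pos.2 (hpsd.apply_self_pos (hnz a a))).le using 1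
      ext p q
      exact hWk _ (hx p.1) _ (hx q.1) _ _
    have h1 := posSemidef_mul_of_multKernelPSD hpsd hnz hΦ' (fun x : ↥(insert a S) ↦ (x : X)) z
    have h2 : (_ • (_ ⊙ _) : Matrix _ _ ℂ).PosSemidef := (h1.hadamard
      (posSemidef_vecMulVec_self_star fun i : ↥(insert a S) ↦ (k i a)⁻¹)).smul
        (hpsd.apply_self_pos (hnz a a)).le
    convert h2 using 1
    ext i j
    have h2 := hnz i a
    have h3 := star_ne_zero.2 (hnz j a)
    have h4 := hnz a a
    simp only [of_apply, Matrix.smul_apply, hadamard_apply, vecMulVec_apply, hΦ i i.2, hΦ j j.2,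
      hWk i i.2 j j.2, Pi.star_apply, smul_eq_mul, star_inv₀]
    field_simp

end Necessity

/-- **The McCullough–Quiggin theorem.** An irreducible PSD kernel `k` has the complete Pick
property if and only if for each `z`, the kernel
`F_z(x,y) = 1 - k(x,z) k(z,y) / (k(z,z) k(x,y))` is PSD. -/
theorem mccullough_quiggin {X : Type*} (k : X → X → ℂ)
    (hpsd : IsPSDKernel k)
    (hnz : ∀ x y : X, k x y ≠ 0)
    (hind : ∀ x y : X, x ≠ y →
      LinearIndependent ℂ ![(fun t => k t x : X → ℂ), (fun t => k t y : X → ℂ)]) :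
    CompletePickProperty k ↔
      ∀ z : X, IsPSDKernel (fun x y => 1 - (k x z * k z y) / (k z z * k x y)) := by
  refine ⟨fun h z ↦ isPSDKernel_of_completePickProperty hpsd hnz h z, fun h ↦ ?_⟩
  rcases isEmpty_or_nonempty X with _ | ⟨⟨z⟩⟩
  · exact fun s t S W hW ↦ ⟨W, fun _ _ ↦ rfl, fun n x ↦ hW n x fun i ↦ isEmptyElim (x i)⟩
  · exact completePickProperty_of_isPSDKernel hpsd hnz z (h z)
end

section
/- Let X be a set, k : X → X → ℂ a PSD kernel, and z ∈ X with k(z,z) ≠ 0. Then the kernel k^z(x,y) := k(x,y) − k(x,z) * k(z,y) / k(z,z) is PSD, i.e., for every n ∈ ℕ and every tuple x : Fin n → X the matrix (k^z (x i) (x j))_{i,j} is positive semidefinite. -/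
open ComplexOrder

/-- If `k` is a PSD kernel and `k(z,z) ≠ 0`, then the kernel
`k^z(x,y) = k(x,y) - k(x,z) k(z,y) / k(z,z)` is PSD. -/
theorem compressed_kernel_psd {X : Type*} (k : X → X → ℂ)
    (hpsd : IsPSDKernel k) (z : X) (hz : k z z ≠ 0) :
    IsPSDKernel fun x y => k x y - k x z * k z y / k z z := by
  intro n x
  have h := (hpsd (n + 1) (Fin.cons z x)).mul_mul_conjTranspose_same
    (Matrix.of fun i : Fin n => (Fin.cons (-k (x i) z / k z z) (Pi.single i 1) : Fin (n + 1) → ℂ))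
  convert h using 1
  ext i j
  simp only [Matrix.mul_apply, Matrix.of_apply, Matrix.conjTranspose_apply, Fin.sum_univ_succ,
    Fin.cons_zero, Fin.cons_succ, Pi.single_apply, apply_ite star, star_one, star_zero, mul_ite,
    ite_mul, mul_one, mul_zero, one_mul, zero_mul, Finset.sum_ite_eq', Finset.mem_univ, if_true]
  field_simp
  ring
end
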